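/- For all z ≥ 0, y ∈ ℝ³ and ξ ∈ ℝ³: ξᵀ D_yX(z,y) ξ ≥ c₈ (χ₀ + R_* z)^{-2} (1+|y|)^{-a} |ξ|², where c₈ = c₄/(ᾱ_N + 2)² and c₄ = (min{1, a₀, a_N}/2^{ᾱ_N})^{1+a}. -/

import Mathlib

open Real
open scoped RealInnerProductSpace

noncomputable section

abbrev E3 := EuclideanSpace ℝ (Fin 3)

/-- The cross product `x × y` in `ℝ³`. -/
def cross3 (x y : E3) : E3 :=
  (WithLp.equiv 2 (Fin 3 → ℝ)).symm
    ![x 1 * y 2 - x 2 * y 1, x 2 * y 0 - x 0 * y 2, x 0 * y 1 - x 1 * y 0]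

/-- The function `g(s) = Σ aᵢ s^{ᾱᵢ}` (with `0⁰ = 1`, as for `Real.rpow`). -/
def gFun (N : ℕ) (α' A : Fin (N + 1) → ℝ) (s : ℝ) : ℝ := ∑ i, A i * s ^ α' i

/-- The Frobenius (Euclidean) norm of the Jacobian matrix of `y ↦ X z y` at `y`. -/
def frobDy (X : ℝ → E3 → E3) (z : ℝ) (y : E3) : ℝ :=
  Real.sqrt (∑ i, ∑ j, (fderiv ℝ (fun y' => X z y') y (EuclideanSpace.single j 1) i) ^ 2)

/-- The cross product with a fixed vector, as a continuous linear map. -/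
def crossCLM (k : E3) : E3 →L[ℝ] E3 :=
  LinearMap.toContinuousLinearMap
    { toFun := cross3 k
      map_add' := fun x y => by
        ext i; fin_cases i <;> simp [cross3] <;> ring
      map_smul' := fun c x => by
        ext i; fin_cases i <;> simp [cross3] <;> ring }

@[simp] lemma crossCLM_apply (k x : E3) : crossCLM k x = cross3 k x := rfl

lemma inner_cross3_self (k x : E3) : ⟪cross3 k x, x⟫ = 0 := by
  simp [cross3, PiLp.inner_apply, Fin.sum_univ_three]
  ring

lemma norm_cross3_le (k x : E3) : ‖cross3 k x‖ ≤ ‖k‖ * ‖x‖ := by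
  refine abs_le_of_sq_le_sq' ?_ (by positivity) |>.2
  rw [mul_pow, EuclideanSpace.norm_sq_eq, EuclideanSpace.norm_sq_eq, EuclideanSpace.norm_sq_eq]
  simp only [cross3, Fin.sum_univ_three, Real.norm_eq_abs, sq_abs]
  simp
  nlinarith [sq_nonneg (k 0 * x 0 + k 1 * x 1 + k 2 * x 2)]

section gFun

variable {N : ℕ} {α' A : Fin (N + 1) → ℝ}

lemma exponent_nonneg (hα0 : α' 0 = 0) (hα : StrictMono α') (i : Fin (N + 1)) : 0 ≤ α' i :=
  hα0 ▸ hα.monotone (Fin.zero_le i)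

lemma gFun_term_le (hA : ∀ i, 0 < A i) {s : ℝ} (hs : 0 ≤ s) (i : Fin (N + 1)) :
    A i * s ^ α' i ≤ gFun N α' A s :=
  Finset.single_le_sum (f := fun i => A i * s ^ α' i)
    (fun j _ => mul_nonneg (hA j).le (Real.rpow_nonneg hs _)) (Finset.mem_univ i)

lemma gFun_pos (hα0 : α' 0 = 0) (hA : ∀ i, 0 < A i) {s : ℝ} (hs : 0 ≤ s) :
    0 < gFun N α' A s :=
  (hA 0).trans_le (by simpa [hα0] using gFun_term_le (α' := α') hA hs 0)

lemma gFun_le (hα0 : α' 0 = 0) (hα : StrictMono α') (hA : ∀ i, 0 < A i) {s : ℝ} (hs : 0 ≤ s) :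
    gFun N α' A s ≤ (∑ i, A i) * max 1 s ^ α' (Fin.last N) := by
  rw [gFun, Finset.sum_mul]
  refine Finset.sum_le_sum fun i _ => mul_le_mul_of_nonneg_left ?_ (hA i).le
  calc s ^ α' i ≤ max 1 s ^ α' i :=
        Real.rpow_le_rpow hs (le_max_right _ _) (exponent_nonneg hα0 hα i)
    _ ≤ _ := Real.rpow_le_rpow_of_exponent_le (le_max_left _ _) (hα.monotone (Fin.le_last i))

lemma le_gFun (hα0 : α' 0 = 0) (hA : ∀ i, 0 < A i) {s : ℝ} (hs : 0 ≤ s) :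
    min 1 (min (A 0) (A (Fin.last N))) * max 1 s ^ α' (Fin.last N) ≤ gFun N α' A s := by
  rcases le_total s 1 with h | h
  · rw [max_eq_left h, Real.one_rpow, mul_one]
    refine le_trans ?_ (gFun_term_le (α' := α') hA hs 0)
    simp [hα0]
  · rw [max_eq_right h]
    refine le_trans ?_ (gFun_term_le (α' := α') hA hs (Fin.last N))
    exact mul_le_mul_of_nonneg_right (by simp) (Real.rpow_nonneg hs _)

lemma continuous_gFun (hα0 : α' 0 = 0) (hα : StrictMono α') : Continuous (gFun N α' A) := by
  unfold gFun
  exact continuous_finsetSum _ fun i _ =>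
    continuous_const.mul (Real.continuous_rpow_const (exponent_nonneg hα0 hα i))

lemma hasDerivAt_gFun {s : ℝ} (hs : 0 < s) :
    HasDerivAt (gFun N α' A) (∑ i, A i * (α' i * s ^ (α' i - 1))) s := by
  unfold gFun
  exact HasDerivAt.fun_sum fun i _ =>
    (Real.hasDerivAt_rpow_const (Or.inl hs.ne')).const_mul (A i)

lemma exists_mul_deriv_gFun (hα0 : α' 0 = 0) (hα : StrictMono α') (hA : ∀ i, 0 < A i)
    {s : ℝ} (hs : 0 < s) :
    ∃ d, HasDerivAt (gFun N α' A) (d / s) s ∧ 0 ≤ d ∧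
      d ≤ α' (Fin.last N) * gFun N α' A s := by
  refine ⟨∑ i, A i * (α' i * s ^ α' i), ?_, ?_, ?_⟩
  · convert hasDerivAt_gFun hs using 1
    rw [Finset.sum_div]
    refine Finset.sum_congr rfl fun i _ => ?_
    rw [Real.rpow_sub_one hs.ne']
    ring
  · exact Finset.sum_nonneg fun i _ => mul_nonneg (hA i).le
      (mul_nonneg (exponent_nonneg hα0 hα i) (Real.rpow_nonneg hs.le _))
  · rw [gFun, Finset.mul_sum]
    refine Finset.sum_le_sum fun i _ => ?_
    have h₁ : α' i ≤ α' (Fin.last N) := hα.monotone (Fin.le_last i)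
    have h₂ : 0 ≤ A i * s ^ α' i := mul_nonneg (hA i).le (Real.rpow_nonneg hs.le _)
    nlinarith

/-- The derivative of `g(|w|) w` along a differentiable curve `w`, including through the origin. -/
lemma exists_hasDerivAt_gFun_norm_smul (hα0 : α' 0 = 0) (hα : StrictMono α')
    (hA : ∀ i, 0 < A i) {w : ℝ → E3} {η : E3} (hw : HasDerivAt w η 0) :
    ∃ (d : ℝ) (u : E3), 0 ≤ d ∧ d ≤ α' (Fin.last N) * gFun N α' A ‖w 0‖ ∧ ‖u‖ ≤ 1 ∧
      HasDerivAt (fun t => gFun N α' A ‖w t‖ • w t)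
        (gFun N α' A ‖w 0‖ • η + (d * ⟪u, η⟫) • u) 0 := by
  by_cases h : w 0 = 0
  · refine ⟨0, 0, le_rfl, mul_nonneg (exponent_nonneg hα0 hα _)
      (gFun_pos hα0 hA (norm_nonneg _)).le, by simp, ?_⟩
    rw [hasDerivAt_iff_tendsto_slope] at hw ⊢
    have hc : ContinuousAt w 0 := (hasDerivAt_iff_tendsto_slope.2 hw).continuousAt
    have hg : Filter.Tendsto (fun t => gFun N α' A ‖w t‖) (nhdsWithin 0 {0}ᶜ)
        (nhds (gFun N α' A ‖w 0‖)) :=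
      (((continuous_gFun hα0 hα).continuousAt.comp hc.norm).tendsto).mono_left
        nhdsWithin_le_nhds
    convert hg.smul hw using 1
    · ext1 t
      simp only [slope_def_module, h, smul_zero, sub_zero]
      rw [smul_comm]
    · simp
  · have hs : 0 < ‖w 0‖ := norm_pos_iff.2 h
    obtain ⟨d, hd, hd0, hd1⟩ := exists_mul_deriv_gFun (A := A) hα0 hα hA hs
    refine ⟨d, ‖w 0‖⁻¹ • w 0, hd0, hd1, by rw [norm_smul]; simp [hs.ne'], ?_⟩
    have hn : HasDerivAt (fun t => ‖w t‖) (⟪w 0, η⟫ / ‖w 0‖) 0 := by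
      have h₁ := (hw.norm_sq).sqrt (by positivity)
      simp only [Real.sqrt_sq (norm_nonneg _)] at h₁
      convert h₁ using 1
      field_simp
    have hu : (d * ⟪‖w 0‖⁻¹ • w 0, η⟫) • ‖w 0‖⁻¹ • w 0 =
        (d / ‖w 0‖ * (⟪w 0, η⟫ / ‖w 0‖)) • w 0 := by
      rw [real_inner_smul_left, smul_smul]
      congr 1
      field_simp
    rw [hu]
    exact (hd.comp (0 : ℝ) hn).smul hw

end gFun

lemma mul_sq_le_inner_of_eq {g d ω : ℝ} {k u ξ η : E3} (hk : ‖k‖ = 1) (hu : ‖u‖ ≤ 1)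
    (hg : 0 ≤ g) (hd : 0 ≤ d) (hω : 0 ≤ ω)
    (h : ξ = g • η + (d * ⟪u, η⟫) • u + ω • cross3 k η) :
    g * ‖ξ‖ ^ 2 ≤ (g + d + ω) ^ 2 * ⟪ξ, η⟫ := by
  have h₁ : g * ‖η‖ ^ 2 ≤ ⟪ξ, η⟫ := by
    rw [h, inner_add_left, inner_add_left, real_inner_smul_left, real_inner_smul_left,
      real_inner_smul_left, inner_cross3_self, real_inner_self_eq_norm_sq]
    nlinarith [mul_nonneg hd (sq_nonneg ⟪u, η⟫)]
  have h₂ : ‖ξ‖ ≤ (g + d + ω) * ‖η‖ := by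
    have hc : ‖cross3 k η‖ ≤ ‖η‖ := by simpa [hk] using norm_cross3_le k η
    have hi : |⟪u, η⟫| ≤ ‖η‖ := (abs_real_inner_le_norm u η).trans
      (mul_le_of_le_one_left (norm_nonneg _) hu)
    have hp : |⟪u, η⟫| * ‖u‖ ≤ ‖η‖ := (mul_le_of_le_one_right (abs_nonneg _) hu).trans hi
    rw [h]
    refine (norm_add₃_le).trans ?_
    rw [norm_smul, norm_smul, norm_smul, norm_mul, Real.norm_of_nonneg hg,
      Real.norm_of_nonneg hd, Real.norm_of_nonneg hω, Real.norm_eq_abs]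
    nlinarith [mul_le_mul_of_nonneg_left hc hω, mul_le_mul_of_nonneg_left hp hd]
  calc g * ‖ξ‖ ^ 2 ≤ g * ((g + d + ω) * ‖η‖) ^ 2 := by gcongr
    _ = (g + d + ω) ^ 2 * (g * ‖η‖ ^ 2) := by ring
    _ ≤ _ := by gcongr

lemma mul_norm_le_norm_smul_add_smul_cross3 (g ω : ℝ) (k v : E3) :
    g * ‖v‖ ≤ ‖g • v + ω • cross3 k v‖ := by
  rcases eq_or_ne v 0 with rfl | hv
  · simp
  have h : g * ‖v‖ * ‖v‖ ≤ ‖g • v + ω • cross3 k v‖ * ‖v‖ := by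
    refine le_trans (le_of_eq ?_) (real_inner_le_norm _ _)
    rw [inner_add_left, real_inner_smul_left, real_inner_smul_left, inner_cross3_self,
      real_inner_self_eq_norm_sq]
    ring
  exact le_of_mul_le_mul_right h (norm_pos_iff.2 hv)

lemma rpow_mul_one_add_rpow_neg_mul_le {b β a s Y : ℝ} (hb : 0 < b) (hb1 : b ≤ 1) (hβ : 0 ≤ β)
    (ha : a = β / (1 + β)) (hY : b * max 1 s ^ β * s ≤ Y) (hY0 : 0 ≤ Y) :
    (b / 2 ^ β) ^ (1 + a) * (1 + Y) ^ (-a) * max 1 s ^ β ≤ b := by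
  have ha0 : 0 ≤ a := ha ▸ by positivity
  set M := max 1 s with hM
  have hM1 : 1 ≤ M := le_max_left _ _
  have hM0 : 0 < M := by linarith
  have h₁ : b * M ^ (1 + β) ≤ 1 + Y := by
    rcases le_total s 1 with h | h
    · rw [hM, max_eq_left h, Real.one_rpow]; linarith
    · have : M = s := max_eq_right h
      rw [Real.rpow_add hM0, Real.rpow_one]
      rw [← this] at hY
      linarith
  have h₂ : b ^ a * M ^ β ≤ (1 + Y) ^ a := by
    have := Real.rpow_le_rpow (by positivity) h₁ ha0
    rwa [Real.mul_rpow hb.le (by positivity), ← Real.rpow_mul hM0.le,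
      show (1 + β) * a = β by rw [ha]; field_simp] at this
  have h₃ : (b / 2 ^ β) ^ (1 + a) ≤ b * b ^ a := by
    rw [← Real.rpow_one_add' hb.le (by linarith)]
    exact Real.rpow_le_rpow (by positivity)
      (div_le_self hb.le (Real.one_le_rpow one_le_two hβ)) (by linarith)
  have hP : 0 < (1 + Y) ^ a := by positivity
  rw [Real.rpow_neg (by positivity), ← div_eq_mul_inv, div_mul_eq_mul_div, div_le_iff₀ hP]
  calc (b / 2 ^ β) ^ (1 + a) * M ^ β ≤ b * b ^ a * M ^ β := by gcongr
    _ = b * (b ^ a * M ^ β) := by ring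
    _ ≤ _ := by gcongr

theorem stmt3
    (N : ℕ) (hN : 1 ≤ N)
    (α' : Fin (N + 1) → ℝ) (hα0 : α' 0 = 0) (hαmono : StrictMono α')
    (A : Fin (N + 1) → ℝ) (hA : ∀ i, 0 < A i)
    (k : E3) (hk : ‖k‖ = 1)
    (Rs : ℝ) (hRs : 0 ≤ Rs)
    (X : ℝ → E3 → E3)
    (hX : ∀ z y, gFun N α' A ‖X z y‖ • X z y + (Rs * z) • cross3 k (X z y) = y)
    (hXC1 : ContDiff ℝ 1 (fun p : ℝ × E3 => X p.1 p.2))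
    (a χ₀ c₄ c₈ : ℝ)
    (ha : a = α' (Fin.last N) / (1 + α' (Fin.last N)))
    (hχ₀ : χ₀ = ∑ i, A i)
    (hc₄ : c₄ = (min 1 (min (A 0) (A (Fin.last N))) / 2 ^ α' (Fin.last N)) ^ (1 + a))
    (hc₈ : c₈ = c₄ / (α' (Fin.last N) + 2) ^ (2 : ℕ))
    (z : ℝ) (hz : 0 ≤ z) (y : E3) (ξ : E3) :
    c₈ * (χ₀ + Rs * z) ^ (-2 : ℝ) * (1 + ‖y‖) ^ (-a) * ‖ξ‖ ^ (2 : ℕ)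
      ≤ ⟪ξ, fderiv ℝ (fun y' => X z y') y ξ⟫ := by
  set β := α' (Fin.last N) with hβ_def
  set ω := Rs * z with hω_def
  set b := min 1 (min (A 0) (A (Fin.last N))) with hb_def
  set η := fderiv ℝ (fun y' => X z y') y ξ with hη_def
  have hβ : 0 ≤ β := exponent_nonneg hα0 hαmono _
  have hω : 0 ≤ ω := mul_nonneg hRs hz
  have hb : 0 < b := lt_min one_pos (lt_min (hA _) (hA _))
  have hχ : 0 < χ₀ := hχ₀ ▸ Finset.sum_pos (fun i _ => hA i) ⟨0, Finset.mem_univ _⟩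
  have hdiff : Differentiable ℝ (fun y' => X z y') :=
    (hXC1.differentiable one_ne_zero).comp ((differentiable_const z).prodMk differentiable_id)
  have hline : HasDerivAt (fun t : ℝ => y + t • ξ) ξ 0 := by
    simpa using ((hasDerivAt_id (0 : ℝ)).smul_const ξ).const_add y
  have hw : HasDerivAt (fun t : ℝ => X z (y + t • ξ)) η 0 := by
    have h : HasFDerivAt (fun y' => X z y') (fderiv ℝ (fun y' => X z y') y)
        (y + (0 : ℝ) • ξ) := by
      simpa using (hdiff y).hasFDerivAt
    exact h.comp_hasDerivAt (0 : ℝ) hline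
  obtain ⟨d, u, hd0, hd1, hu, hder⟩ := exists_hasDerivAt_gFun_norm_smul hα0 hαmono hA hw
  simp only [zero_smul, add_zero] at hd1 hder
  set s := ‖X z y‖ with hs_def
  have hs : 0 ≤ s := norm_nonneg _
  set g := gFun N α' A s with hg_def
  have hg : 0 < g := gFun_pos hα0 hA hs
  have hξ : ξ = g • η + (d * ⟪u, η⟫) • u + ω • cross3 k η := by
    have h := hder.add (((crossCLM k).hasFDerivAt.comp_hasDerivAt (0 : ℝ) hw).const_smul ω)
    refine hline.unique (h.congr_of_eventuallyEq (Filter.Eventually.of_forall fun t => ?_))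
    exact (hX z (y + t • ξ)).symm
  have hmain := mul_sq_le_inner_of_eq hk hu hg.le hd0 hω hξ
  set m := max 1 s ^ β with hm_def
  have hm : 1 ≤ m := Real.one_le_rpow (le_max_left _ _) hβ
  have hgu : g ≤ χ₀ * m := hχ₀ ▸ gFun_le hα0 hαmono hA hs
  have hgl : b * m ≤ g := le_gFun hα0 hA hs
  have hY : b * m * s ≤ ‖y‖ := by
    refine (mul_le_mul_of_nonneg_right hgl hs).trans ?_
    conv_rhs => rw [← hX z y]
    exact mul_norm_le_norm_smul_add_smul_cross3 _ _ _ _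
  have hc : c₄ * (1 + ‖y‖) ^ (-a) * m ≤ b := by
    rw [hc₄]
    exact rpow_mul_one_add_rpow_neg_mul_le hb (min_le_left _ _) hβ ha hY (norm_nonneg _)
  have hden : g + d + ω ≤ (β + 2) * (χ₀ + ω) * m := by
    nlinarith [mul_le_mul_of_nonneg_left hgu hβ, mul_nonneg hω (sub_nonneg.2 hm),
      mul_nonneg hβ (mul_nonneg hω (zero_le_one.trans hm)),
      mul_nonneg hχ.le (zero_le_one.trans hm), mul_nonneg hω (zero_le_one.trans hm)]
  have hQ : 0 < g + d + ω := by positivity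
  have hc₄m : c₄ * (1 + ‖y‖) ^ (-a) * m ^ 2 ≤ g := by
    nlinarith [mul_le_mul_of_nonneg_right hc (zero_le_one.trans hm)]
  have hK : 0 ≤ c₄ * (1 + ‖y‖) ^ (-a) := by rw [hc₄]; positivity
  refine le_of_mul_le_mul_left (le_trans ?_ hmain) (pow_pos hQ 2)
  rw [hc₈, Real.rpow_neg (by positivity), Real.rpow_two]
  calc (g + d + ω) ^ 2 *
        (c₄ / (β + 2) ^ 2 * ((χ₀ + ω) ^ 2)⁻¹ * (1 + ‖y‖) ^ (-a) * ‖ξ‖ ^ 2)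
      = (g + d + ω) ^ 2 * (((β + 2) ^ 2 * (χ₀ + ω) ^ 2)⁻¹ *
        (c₄ * (1 + ‖y‖) ^ (-a)) * ‖ξ‖ ^ 2) := by
        rw [mul_inv]; ring
    _ ≤ ((β + 2) * (χ₀ + ω) * m) ^ 2 * (((β + 2) ^ 2 * (χ₀ + ω) ^ 2)⁻¹ *
        (c₄ * (1 + ‖y‖) ^ (-a)) * ‖ξ‖ ^ 2) := by gcongr
    _ = c₄ * (1 + ‖y‖) ^ (-a) * m ^ 2 * ‖ξ‖ ^ 2 := by field_simp
    _ ≤ g * ‖ξ‖ ^ 2 := by gcongr
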